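/- arXiv:1709.00376 — 2 statements merged into one kernel-verified Lean document; each statement's English description precedes it below -/
import Mathlib

section
/- Let ω ∈ ℝ³ with ω ≠ 0 and cos ‖ω‖ ≠ 1, write θ = ‖ω‖ and K = ω̂. Let D = I + ((1 − cos θ)/θ²) K + ((θ − sin θ)/θ³) K² and E = I − (1/2) K + (((1/2)θ sin θ + cos θ − 1)/(θ²(cos θ − 1))) K². Then D · E = I and E · D = I, where I is the 3×3 identity matrix. -/
open Real

/-- The hat map `∧ : ℝ³ → 𝔰𝔬(3)`. -/
noncomputable def hatSO3 (ω : EuclideanSpace ℝ (Fin 3)) : Matrix (Fin 3) (Fin 3) ℝ :=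
  !![0, -ω 2, ω 1; ω 2, 0, -ω 0; -ω 1, ω 0, 0]

/-- The cubic relation satisfied by the hat matrix, `ω̂³ = -‖ω‖² ω̂`. -/
theorem hatSO3_pow_three (ω : EuclideanSpace ℝ (Fin 3)) :
    hatSO3 ω ^ 3 = (-(‖ω‖ ^ 2)) • hatSO3 ω := by
  rw [EuclideanSpace.real_norm_sq_eq, Fin.sum_univ_three]
  ext i j
  fin_cases i <;> fin_cases j <;>
    simp [hatSO3, pow_succ, Matrix.mul_apply, Fin.sum_univ_three] <;> ring

/-- In an algebra, an element with `K³ = -s K` yields mutually inverse quadratic polynomials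
as soon as the two reduced coefficients of their product vanish. -/
theorem quadratic_mul_quadratic_eq_one {A : Type*} [Ring A] [Algebra ℝ A] {K : A}
    {s a b c d : ℝ} (hK : K ^ 3 = (-s) • K) (h₁ : a + c - s * (a * d + b * c) = 0)
    (h₂ : b + d + a * c - s * (b * d) = 0) :
    (1 + a • K + b • K ^ 2) * (1 + c • K + d • K ^ 2) = 1 := by
  have hK₄ : K ^ 4 = (-s) • K ^ 2 := by
    rw [pow_succ, hK, smul_mul_assoc, ← pow_two]
  have expand : (1 + a • K + b • K ^ 2) * (1 + c • K + d • K ^ 2) =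
      1 + (a + c) • K + (b + d + a * c) • K ^ 2 + (a * d + b * c) • K ^ 3
        + (b * d) • K ^ 4 := by
    have h₃ : K * K ^ 2 = K ^ 3 := (pow_succ' K 2).symm
    have h₃' : K ^ 2 * K = K ^ 3 := (pow_succ K 2).symm
    have h₄ : K ^ 2 * K ^ 2 = K ^ 4 := (pow_add K 2 2).symm
    simp only [mul_add, add_mul, smul_mul_assoc, mul_smul_comm, one_mul, mul_one,
      ← pow_two K, h₃, h₃', h₄]
    module
  calc
    _ = 1 + (a + c - s * (a * d + b * c)) • K + (b + d + a * c - s * (b * d)) • K ^ 2 := by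
      rw [expand, hK, hK₄]
      module
    _ = 1 := by simp [h₁, h₂]

/-- The closed-form expression for `dexp⁻¹(ω̂)` on `SO(3)` is the two-sided inverse of
the closed-form expression for `dexp(ω̂)`. -/
theorem dexp_inv_so3 (ω : EuclideanSpace ℝ (Fin 3)) (hω : ω ≠ 0)
    (hcos : cos ‖ω‖ ≠ 1)
    (D E : Matrix (Fin 3) (Fin 3) ℝ)
    (hD : D = 1 + ((1 - cos ‖ω‖) / ‖ω‖ ^ 2) • hatSO3 ω
      + ((‖ω‖ - sin ‖ω‖) / ‖ω‖ ^ 3) • hatSO3 ω ^ 2)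
    (hE : E = 1 - (1 / 2 : ℝ) • hatSO3 ω
      + (((1 / 2) * ‖ω‖ * sin ‖ω‖ + cos ‖ω‖ - 1) / (‖ω‖ ^ 2 * (cos ‖ω‖ - 1))) •
          hatSO3 ω ^ 2) :
    D * E = 1 ∧ E * D = 1 := by
  have hθ : ‖ω‖ ≠ 0 := norm_ne_zero_iff.mpr hω
  have hc : cos ‖ω‖ - 1 ≠ 0 := sub_ne_zero.mpr hcos
  have hDE : D * E = 1 := by
    rw [hD, hE, sub_eq_add_neg 1 ((1 / 2 : ℝ) • hatSO3 ω), ← neg_smul]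
    apply quadratic_mul_quadratic_eq_one (hatSO3_pow_three ω)
    · field_simp
      ring
    · field_simp
      linear_combination ‖ω‖ * sin_sq_add_cos_sq ‖ω‖
  exact ⟨hDE, mul_eq_one_comm.mp hDE⟩
end

section
/- Let ω, u, v ∈ ℝ with ω ≠ 0, and let A be the 3×3 real matrix with rows (0, 0, 0), (v, 0, −ω), (−u, ω, 0). Then the series ∑_{j=0}^∞ (1/(j+1)!) A^j converges and equals the 3×3 matrix with rows (1, 0, 0), (a₁, sin ω/ω, −(1 − cos ω)/ω), (a₂, (1 − cos ω)/ω, sin ω/ω), where a₁ = (u(ω − sin ω) + v(1 − cos ω))/ω² and a₂ = (v(ω − sin ω) − u(1 − cos ω))/ω². -/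
open Real

theorem Real.hasSum_sin_div {x : ℝ} (hx : x ≠ 0) :
    HasSum (fun k : ℕ => (((2 * k + 1).factorial : ℝ))⁻¹ * (-x ^ 2) ^ k) (sin x / x) := by
  refine ((Real.hasSum_sin x).div_const x).congr_fun fun k => ?_
  rw [neg_pow, ← pow_mul, pow_succ x]
  field_simp

theorem Real.hasSum_one_sub_cos_div_sq {x : ℝ} (hx : x ≠ 0) :
    HasSum (fun k : ℕ => (((2 * k + 1 + 1).factorial : ℝ))⁻¹ * (-x ^ 2) ^ k)
      ((1 - cos x) / x ^ 2) := by
  have h := ((hasSum_nat_add_iff' 1).mpr (Real.hasSum_cos x)).div_const (-x ^ 2)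
  have hval : (1 - cos x) / x ^ 2 =
      (cos x - ∑ i ∈ Finset.range 1, (-1) ^ i * x ^ (2 * i) / ((2 * i).factorial : ℝ)) / -x ^ 2 := by
    simp only [Finset.sum_range_one, mul_zero, pow_zero, Nat.factorial_zero, Nat.cast_one]
    field_simp
    ring
  rw [hval]
  refine h.congr_fun fun k => ?_
  rw [neg_pow, ← pow_mul, show 2 * (k + 1) = 2 * k + 1 + 1 by ring]
  field_simp
  ring

/-- The series `∑ A ^ j / (j + 1)!` for an element of a real topological algebra satisfying
`A ^ 3 = -ω² A`. -/
theorem hasSum_inv_factorial_succ_smul_pow_of_pow_three {R : Type*} [Ring R] [Algebra ℝ R]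
    [TopologicalSpace R] [IsTopologicalAddGroup R] [ContinuousSMul ℝ R]
    {ω : ℝ} (hω : ω ≠ 0) {A : R} (hA : A ^ 3 = (-ω ^ 2) • A) :
    HasSum (fun j : ℕ => (((j + 1).factorial : ℝ))⁻¹ • A ^ j)
      (1 + ((1 - cos ω) / ω ^ 2) • A + ((ω - sin ω) / ω ^ 3) • A ^ 2) := by
  have hodd (k : ℕ) : A ^ (2 * k + 1) = ((-ω ^ 2) ^ k) • A := by
    induction k with
    | zero => simp
    | succ k ih =>
      rw [show 2 * (k + 1) + 1 = 2 * k + 1 + 2 by ring, pow_add, ih, smul_mul_assoc,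
        ← pow_succ', hA, smul_smul, ← pow_succ]
  have heven (k : ℕ) : A ^ (2 * k) = ((-ω ^ 2) ^ k) • ((-ω ^ 2)⁻¹ • A ^ 2) +
      if k = 0 then 1 - (-ω ^ 2)⁻¹ • A ^ 2 else 0 := by
    cases k with
    | zero => simp
    | succ k =>
      rw [show 2 * (k + 1) = 2 * k + 1 + 1 by ring, pow_succ, hodd, smul_mul_assoc, ← sq,
        smul_smul, pow_succ (-ω ^ 2), mul_assoc, mul_inv_cancel₀ (by simpa using hω)]
      simp
  have hsum_even : HasSum (fun k : ℕ => (((2 * k + 1).factorial : ℝ))⁻¹ • A ^ (2 * k))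
      ((sin ω / ω) • ((-ω ^ 2)⁻¹ • A ^ 2) + (1 - (-ω ^ 2)⁻¹ • A ^ 2)) := by
    convert ((Real.hasSum_sin_div hω).smul_const ((-ω ^ 2)⁻¹ • A ^ 2)).add
      (hasSum_ite_eq (0 : ℕ) (1 - (-ω ^ 2)⁻¹ • A ^ 2)) using 2 with k
    rw [heven, smul_add, smul_smul]
    split_ifs with hk <;> simp [hk]
  have hsum_odd : HasSum (fun k : ℕ => (((2 * k + 1 + 1).factorial : ℝ))⁻¹ • A ^ (2 * k + 1))
      (((1 - cos ω) / ω ^ 2) • A) := by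
    convert (Real.hasSum_one_sub_cos_div_sq hω).smul_const A using 2 with k
    rw [hodd, smul_smul]
  convert HasSum.even_add_odd (f := fun j : ℕ => (((j + 1).factorial : ℝ))⁻¹ • A ^ j)
    hsum_even hsum_odd using 1
  match_scalars <;> field_simp
  ring

/-- Exact closed form of `dexp` on `SE(2)`: with `A` the matrix representation of
`ad_ξ` for `ξ = (ω, u, v) ∈ 𝔰𝔢(2)` and `ω ≠ 0`, the series `∑_{j≥0} A^j/(j+1)!`
converges to the stated closed form. -/
theorem dexp_se2_closed_form (ω u v : ℝ) (hω : ω ≠ 0)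
    (A : Matrix (Fin 3) (Fin 3) ℝ)
    (hA : A = !![0, 0, 0; v, 0, -ω; -u, ω, 0]) :
    HasSum (fun j : ℕ => (((j + 1).factorial : ℝ))⁻¹ • A ^ j)
      !![1, 0, 0;
         (u * (ω - sin ω) + v * (1 - cos ω)) / ω ^ 2, sin ω / ω, -((1 - cos ω) / ω);
         (v * (ω - sin ω) - u * (1 - cos ω)) / ω ^ 2, (1 - cos ω) / ω, sin ω / ω] := by
  have hcube : A ^ 3 = (-ω ^ 2) • A := by
    subst hA
    ext i j
    fin_cases i <;> fin_cases j <;> simp [pow_succ, Matrix.mul_apply, Fin.sum_univ_three]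
  have hval : !![1, 0, 0;
      (u * (ω - sin ω) + v * (1 - cos ω)) / ω ^ 2, sin ω / ω, -((1 - cos ω) / ω);
      (v * (ω - sin ω) - u * (1 - cos ω)) / ω ^ 2, (1 - cos ω) / ω, sin ω / ω] =
      1 + ((1 - cos ω) / ω ^ 2) • A + ((ω - sin ω) / ω ^ 3) • A ^ 2 := by
    subst hA
    ext i j
    fin_cases i <;> fin_cases j <;> simp [sq]
    all_goals field_simp
    all_goals ring
  rw [hval]
  exact hasSum_inv_factorial_succ_smul_pow_of_pow_three hω hcube
end
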